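/- arXiv:1405.0847 — 2 statements merged into one kernel-verified Lean document; each statement's English description precedes it below -/
import Mathlib

section
/- Let (Γ,S) be a 2-balanced symmetric SRS with rules S₁,…,S_m such that every rule {a₁a₂, b₁b₂} ∈ S satisfies a₁ = b₁ or a₂ = b₂. Let ␣, $, ¢, x₁, …, x_m be new symbols, Δ₁ = {$, ¢, x₁, …, x_m} (special symbols), Δ₂ = (Γ∪{␣}) × (Γ∪{␣}) (pair symbols), Δ = Δ₁ ∪ Δ₂. Let H = (Δ,E) be the digraph with arcs: ((a,b),(b,c)) for all a,c ∈ Γ∪{␣} and b ∈ Γ; ($,(␣,a)) and ((a,␣),¢) for all a ∈ Γ; and, for each i with S_i = {a₁a₂, b₁b₂} and every c ∈ Γ∪{␣}: ((c,a₁), x_i), ((c,b₁), x_i), (x_i, (a₂,c)), (x_i, (b₂,c)). For a word a₁a₂…a_n ∈ Γⁿ define ψ(a₁…a_n) = $ (␣,a₁)(a₁,a₂)(a₂,a₃)…(a_{n−1},a_n)(a_n,␣) ¢ ∈ Δ^{n+3}. Then for all s,t ∈ Γⁿ: s ↔*_S t if and only if ψ(s) and ψ(t) are connected by H-word reconfiguration.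 -/
/-- One rewriting step of a string rewriting system `R`: replace one occurrence of the
left-hand side of a rule by the right-hand side. -/
def RwStep {A : Type*} (R : Set (List A × List A)) (s t : List A) : Prop :=
  ∃ p ∈ R, ∃ u v : List A, s = u ++ p.1 ++ v ∧ t = u ++ p.2 ++ v

/-- The alphabet `Δ`: `Sum.inl (Sum.inl true)` is the special symbol `$`,
`Sum.inl (Sum.inl false)` is `¢`, `Sum.inl (Sum.inr i)` is `xᵢ`, and `Sum.inr (a, b)`
is the pair symbol `(a, b)` over `Γ ∪ {␣}`, where `none` stands for the blank `␣`. -/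
abbrev DeltaSym (A : Type*) (m : ℕ) := (Bool ⊕ Fin m) ⊕ (Option A × Option A)

/-- The arcs `E` of the digraph `H = (Δ, E)` built from the rules `S₁, …, S_m`,
where rule `Sᵢ = {a₁a₂, b₁b₂}` is represented as `rules i = ((a₁, a₂), (b₁, b₂))`. -/
def arcRel {A : Type*} {m : ℕ} (rules : Fin m → (A × A) × (A × A)) :
    DeltaSym A m → DeltaSym A m → Prop := fun d e =>
  (∃ (a : Option A) (b : A) (c : Option A),
      d = Sum.inr (a, some b) ∧ e = Sum.inr (some b, c)) ∨
  (∃ a : A, d = Sum.inl (Sum.inl true) ∧ e = Sum.inr (none, some a)) ∨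
  (∃ a : A, d = Sum.inr (some a, none) ∧ e = Sum.inl (Sum.inl false)) ∨
  (∃ (i : Fin m) (c : Option A),
      (d = Sum.inr (c, some (rules i).1.1) ∨ d = Sum.inr (c, some (rules i).2.1)) ∧
      e = Sum.inl (Sum.inr i)) ∨
  (∃ (i : Fin m) (c : Option A),
      d = Sum.inl (Sum.inr i) ∧
      (e = Sum.inr (some (rules i).1.2, c) ∨ e = Sum.inr (some (rules i).2.2, c)))

/-- The encoding `ψ(a₁…a_n) = $ (␣,a₁)(a₁,a₂)…(a_{n−1},a_n)(a_n,␣) ¢`. -/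
def psiEnc {A : Type*} (m : ℕ) (w : List A) : List (DeltaSym A m) :=
  Sum.inl (Sum.inl true) ::
    ((List.zip ((none : Option A) :: w.map some) (w.map some ++ [none])).map Sum.inr ++
      [Sum.inl (Sum.inl false)])

/-- Two words differ in exactly one position. -/
def OneDiff {D : Type*} (w w' : List D) : Prop :=
  ∃ (u : List D) (a b : D) (v : List D), a ≠ b ∧ w = u ++ a :: v ∧ w' = u ++ b :: v

/-- Adjacency of `H`-words: both are `H`-words and they differ in exactly one position.
`H`-word reconfiguration reachability is the reflexive transitive closure of this. -/
def HWordAdj {D : Type*} (E : D → D → Prop) (w w' : List D) : Prop :=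
  w.Chain' E ∧ w'.Chain' E ∧ OneDiff w w'

/-- The symmetric 2-balanced SRS whose rules are `S₁, …, S_m` (each in both directions). -/
def srsOfRules {A : Type*} {m : ℕ} (rules : Fin m → (A × A) × (A × A)) :
    Set (List A × List A) :=
  {p | ∃ i : Fin m,
    p = ([(rules i).1.1, (rules i).1.2], [(rules i).2.1, (rules i).2.2]) ∨
    p = ([(rules i).2.1, (rules i).2.2], [(rules i).1.1, (rules i).1.2])}

/-- The letter read off from two consecutive symbols of an `H`-word, as a list of length
at most one. -/
def boundaryLetter {A : Type*} {m : ℕ} : DeltaSym A m → DeltaSym A m → List A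
  | Sum.inr (_, b), _ => b.toList
  | Sum.inl (Sum.inr _), Sum.inr (a, _) => a.toList
  | _, _ => []

/-- The word over `A` read off from the boundaries of an `H`-word. -/
def decodeWord {A : Type*} {m : ℕ} : List (DeltaSym A m) → List A
  | [] => []
  | [_] => []
  | p :: q :: w => boundaryLetter p q ++ decodeWord (q :: w)

/-- The pair symbols `(o,a₁)(a₁,a₂)…(a_n,␣)`. -/
def pairEnc {A : Type*} (m : ℕ) (o : Option A) (w : List A) : List (DeltaSym A m) :=
  (List.zip (o :: w.map some) (w.map some ++ [none])).map Sum.inr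

section Decode

variable {A : Type*} {m : ℕ}

theorem pairEnc_nil (o : Option A) : pairEnc m o [] = [Sum.inr (o, none)] := rfl

theorem pairEnc_cons (o : Option A) (x : A) (w : List A) :
    pairEnc m o (x :: w) = Sum.inr (o, some x) :: pairEnc m (some x) w := rfl

theorem psiEnc_eq (w : List A) :
    psiEnc m w = Sum.inl (Sum.inl true) :: (pairEnc m none w ++ [Sum.inl (Sum.inl false)]) := rfl

theorem decodeWord_append_cons (u v : List (DeltaSym A m)) (a : DeltaSym A m) :
    decodeWord (u ++ a :: v) = decodeWord (u ++ [a]) ++ decodeWord (a :: v) := by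
  induction u with
  | nil => simp [decodeWord]
  | cons p u ih =>
    cases u with
    | nil => simp [decodeWord]
    | cons q u =>
      simp only [List.cons_append, decodeWord, List.append_assoc] at ih ⊢
      rw [ih]

theorem decodeWord_pairEnc (o : Option A) (w : List A) :
    decodeWord (pairEnc m o w ++ [Sum.inl (Sum.inl false)]) = w := by
  induction w generalizing o with
  | nil => simp [pairEnc_nil, decodeWord, boundaryLetter]
  | cons x w ih =>
    have h := ih (some x)
    rw [pairEnc_cons]
    cases w <;>
      simp_all [pairEnc_nil, pairEnc_cons, decodeWord, boundaryLetter]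

theorem decodeWord_psiEnc (w : List A) : decodeWord (psiEnc m w) = w := by
  have h := decodeWord_pairEnc (m := m) none w
  rw [psiEnc_eq]
  cases w <;> simp_all [pairEnc_nil, pairEnc_cons, decodeWord, boundaryLetter]

end Decode

theorem RwStep.append {A : Type*} {R : Set (List A × List A)} {s t : List A}
    (h : RwStep R s t) (l r : List A) : RwStep R (l ++ s ++ r) (l ++ t ++ r) := by
  obtain ⟨p, hp, u, v, rfl, rfl⟩ := h
  exact ⟨p, hp, l ++ u, v ++ r, by simp, by simp⟩

theorem RwStep.reflTransGen_append {A : Type*} {R : Set (List A × List A)} {s t : List A}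
    (h : Relation.ReflTransGen (RwStep R) s t) (l r : List A) :
    Relation.ReflTransGen (RwStep R) (l ++ s ++ r) (l ++ t ++ r) :=
  h.lift (fun x => l ++ x ++ r) fun _ _ hab => hab.append l r

section Rules

variable {A : Type*} {m : ℕ} {rules : Fin m → (A × A) × (A × A)}

theorem RwStep.of_rule (i : Fin m) :
    RwStep (srsOfRules rules) [(rules i).1.1, (rules i).1.2] [(rules i).2.1, (rules i).2.2] :=
  ⟨_, ⟨i, Or.inl rfl⟩, [], [], by simp, by simp⟩

theorem RwStep.of_rule_symm (i : Fin m) :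
    RwStep (srsOfRules rules) [(rules i).2.1, (rules i).2.2] [(rules i).1.1, (rules i).1.2] :=
  ⟨_, ⟨i, Or.inr rfl⟩, [], [], by simp, by simp⟩

theorem reflTransGen_change_right {i : Fin m}
    (hone : (rules i).1.1 = (rules i).2.1 ∨ (rules i).1.2 = (rules i).2.2) {d e e' : A}
    (hd : d = (rules i).1.1 ∨ d = (rules i).2.1) (he : e = (rules i).1.2 ∨ e = (rules i).2.2)
    (he' : e' = (rules i).1.2 ∨ e' = (rules i).2.2) :
    Relation.ReflTransGen (RwStep (srsOfRules rules)) [d, e] [d, e'] := by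
  by_cases hee : e = e'
  · rw [hee]
  have h1 := Relation.ReflTransGen.single (RwStep.of_rule (rules := rules) i)
  have h2 := Relation.ReflTransGen.single (RwStep.of_rule_symm (rules := rules) i)
  grind

theorem reflTransGen_change_left {i : Fin m}
    (hone : (rules i).1.1 = (rules i).2.1 ∨ (rules i).1.2 = (rules i).2.2) {d d' e : A}
    (hd : d = (rules i).1.1 ∨ d = (rules i).2.1) (hd' : d' = (rules i).1.1 ∨ d' = (rules i).2.1)
    (he : e = (rules i).1.2 ∨ e = (rules i).2.2) :
    Relation.ReflTransGen (RwStep (srsOfRules rules)) [d, e] [d', e] := by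
  by_cases hdd : d = d'
  · rw [hdd]
  have h1 := Relation.ReflTransGen.single (RwStep.of_rule (rules := rules) i)
  have h2 := Relation.ReflTransGen.single (RwStep.of_rule_symm (rules := rules) i)
  grind

theorem arcRel_to_rule {p : DeltaSym A m} {i : Fin m}
    (h : arcRel rules p (Sum.inl (Sum.inr i))) :
    ∃ c d, p = Sum.inr (c, some d) ∧ (d = (rules i).1.1 ∨ d = (rules i).2.1) := by
  simp only [arcRel] at h
  aesop

theorem arcRel_from_rule {q : DeltaSym A m} {i : Fin m}
    (h : arcRel rules (Sum.inl (Sum.inr i)) q) :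
    ∃ e c, q = Sum.inr (some e, c) ∧ (e = (rules i).1.2 ∨ e = (rules i).2.2) := by
  simp only [arcRel] at h
  aesop

/-- Unless the second symbol is a rule symbol, it determines the letter on its left boundary. -/
theorem boundaryLetter_eq_of_arcRel {a b q : DeltaSym A m}
    (ha : arcRel rules a q) (hb : arcRel rules b q) (hq : ∀ k, q ≠ Sum.inl (Sum.inr k)) :
    boundaryLetter a q = boundaryLetter b q := by
  have key : ∀ {p}, arcRel rules p q →
      boundaryLetter p q = match q with
        | Sum.inr (c, _) => c.toList
        | _ => [] := by
    intro p hp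
    simp only [arcRel] at hp
    rcases q with (_ | k) | ⟨c, d⟩
    · rcases hp with h | h | h | h | h <;> simp_all
      grind [boundaryLetter]
    · exact absurd rfl (hq k)
    · rcases hp with h | h | h | h | h <;> simp_all <;> grind [boundaryLetter]
  rw [key ha, key hb]

theorem decodeWord_change_last
    (hone : ∀ i, (rules i).1.1 = (rules i).2.1 ∨ (rules i).1.2 = (rules i).2.2)
    {u : List (DeltaSym A m)} {a b : DeltaSym A m}
    (hu : ∀ k, u.head? ≠ some (Sum.inl (Sum.inr k)))
    (ha : (u ++ [a]).IsChain (arcRel rules)) (hb : (u ++ [b]).IsChain (arcRel rules)) :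
    Relation.ReflTransGen (RwStep (srsOfRules rules))
      (decodeWord (u ++ [a])) (decodeWord (u ++ [b])) := by
  rcases u.eq_nil_or_concat' with rfl | ⟨u, p, rfl⟩
  · exact .refl
  rw [List.append_assoc, List.singleton_append, List.isChain_append_cons_cons] at ha hb
  simp only [List.append_assoc, List.singleton_append]
  rw [decodeWord_append_cons u [a], decodeWord_append_cons u [b]]
  rcases p with (_ | i) | ⟨c, d⟩
  · exact .refl
  · rcases u.eq_nil_or_concat' with rfl | ⟨u, p, rfl⟩
    · simp at hu
    have hp := ha.1
    rw [List.append_assoc, List.singleton_append, List.isChain_append_cons_cons] at hp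
    obtain ⟨c, d, rfl, hd⟩ := arcRel_to_rule hp.2.1
    obtain ⟨e, c, rfl, he⟩ := arcRel_from_rule ha.2.1
    obtain ⟨e', c', rfl, he'⟩ := arcRel_from_rule hb.2.1
    simp only [List.append_assoc, List.singleton_append]
    rw [decodeWord_append_cons u [_]]
    simpa [decodeWord, boundaryLetter] using RwStep.reflTransGen_append
      (reflTransGen_change_right (hone i) hd he he') (decodeWord (u ++ [Sum.inr (_, some d)])) []
  · exact .refl

theorem decodeWord_change_head
    (hone : ∀ i, (rules i).1.1 = (rules i).2.1 ∨ (rules i).1.2 = (rules i).2.2)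
    {v : List (DeltaSym A m)} {a b : DeltaSym A m}
    (hv : ∀ k, v.getLast? ≠ some (Sum.inl (Sum.inr k)))
    (ha : (a :: v).IsChain (arcRel rules)) (hb : (b :: v).IsChain (arcRel rules)) :
    Relation.ReflTransGen (RwStep (srsOfRules rules))
      (decodeWord (a :: v)) (decodeWord (b :: v)) := by
  cases v with
  | nil => exact .refl
  | cons q v =>
    rw [List.isChain_cons_cons] at ha hb
    by_cases hq : ∃ k, q = Sum.inl (Sum.inr k)
    · obtain ⟨k, rfl⟩ := hq
      cases v with
      | nil => simp at hv
      | cons r v =>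
        obtain ⟨e, c, rfl, he⟩ := arcRel_from_rule (List.isChain_cons_cons.1 ha.2).1
        obtain ⟨c, d, rfl, hd⟩ := arcRel_to_rule ha.1
        obtain ⟨c', d', rfl, hd'⟩ := arcRel_to_rule hb.1
        simpa [decodeWord, boundaryLetter] using RwStep.reflTransGen_append
          (reflTransGen_change_left (hone k) hd hd' he) [] (decodeWord (Sum.inr (some e, _) :: v))
    · push Not at hq
      simp only [decodeWord]
      rw [boundaryLetter_eq_of_arcRel ha.1 hb.1 hq]

theorem arcRel_dollar_unique {b q : DeltaSym A m}
    (ha : arcRel rules (Sum.inl (Sum.inl true)) q) (hb : arcRel rules b q) :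
    b = Sum.inl (Sum.inl true) := by
  simp only [arcRel] at ha hb
  aesop

theorem arcRel_cent_unique {b p : DeltaSym A m}
    (ha : arcRel rules p (Sum.inl (Sum.inl false))) (hb : arcRel rules p b) :
    b = Sum.inl (Sum.inl false) := by
  simp only [arcRel] at ha hb
  aesop

theorem HWordAdj.endpoints {w w' : List (DeltaSym A m)} (h : HWordAdj (arcRel rules) w w')
    (h1 : w.head? = some (Sum.inl (Sum.inl true)))
    (h2 : w.getLast? = some (Sum.inl (Sum.inl false))) :
    w'.head? = some (Sum.inl (Sum.inl true)) ∧ w'.getLast? = some (Sum.inl (Sum.inl false)) := by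
  obtain ⟨hw : w.IsChain _, hw' : w'.IsChain _, u, a, b, v, -, rfl, rfl⟩ := h
  constructor
  · cases u with
    | cons p u => simpa using h1
    | nil =>
      cases v with
      | nil => simp_all
      | cons q v =>
        obtain rfl : a = Sum.inl (Sum.inl true) := by simpa using h1
        simpa using arcRel_dollar_unique (List.isChain_cons_cons.1 hw).1
          (List.isChain_cons_cons.1 hw').1
  · cases v with
    | cons q v => simpa using h2
    | nil =>
      obtain rfl : a = Sum.inl (Sum.inl false) := by simpa using h2
      rcases u.eq_nil_or_concat' with rfl | ⟨u, p, rfl⟩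
      · simp at h1
      rw [List.append_assoc, List.singleton_append] at hw hw'
      simpa using arcRel_cent_unique (List.isChain_append_cons_cons.1 hw).2.1
        (List.isChain_append_cons_cons.1 hw').2.1

theorem HWordAdj.reflTransGen_decodeWord
    (hone : ∀ i, (rules i).1.1 = (rules i).2.1 ∨ (rules i).1.2 = (rules i).2.2)
    {w w' : List (DeltaSym A m)} (h : HWordAdj (arcRel rules) w w')
    (h1 : w.head? = some (Sum.inl (Sum.inl true)))
    (h2 : w.getLast? = some (Sum.inl (Sum.inl false))) :
    Relation.ReflTransGen (RwStep (srsOfRules rules)) (decodeWord w) (decodeWord w') := by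
  obtain ⟨hw : w.IsChain _, hw' : w'.IsChain _, u, a, b, v, -, rfl, rfl⟩ := h
  have hu : ∀ k, u.head? ≠ some (Sum.inl (Sum.inr k)) := by
    cases u <;> simp_all
  have hv : ∀ k, v.getLast? ≠ some (Sum.inl (Sum.inr k)) := by
    cases v <;> simp_all
  have hL := decodeWord_change_last hone hu (List.isChain_split.1 hw).1
    (List.isChain_split.1 hw').1
  have hR := decodeWord_change_head hone hv (List.isChain_split.1 hw).2
    (List.isChain_split.1 hw').2
  rw [decodeWord_append_cons u v a, decodeWord_append_cons u v b]
  have hL' := RwStep.reflTransGen_append hL [] (decodeWord (a :: v))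
  have hR' := RwStep.reflTransGen_append hR (decodeWord (u ++ [b])) []
  simp only [List.nil_append, List.append_nil] at hL' hR'
  exact hL'.trans hR'

theorem HWordAdj.reflTransGen_invariant
    (hone : ∀ i, (rules i).1.1 = (rules i).2.1 ∨ (rules i).1.2 = (rules i).2.2)
    {w w' : List (DeltaSym A m)} (h : Relation.ReflTransGen (HWordAdj (arcRel rules)) w w')
    (h1 : w.head? = some (Sum.inl (Sum.inl true)))
    (h2 : w.getLast? = some (Sum.inl (Sum.inl false))) :
    Relation.ReflTransGen (RwStep (srsOfRules rules)) (decodeWord w) (decodeWord w') := by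
  induction h using Relation.ReflTransGen.head_induction_on with
  | refl => exact .refl
  | head hab _ ih =>
    have he := hab.endpoints h1 h2
    exact (hab.reflTransGen_decodeWord hone h1 h2).trans (ih he.1 he.2)

theorem isChain_pairEnc (o : Option A) (w : List A) (h : o = none → w ≠ []) :
    (pairEnc m o w ++ [Sum.inl (Sum.inl false)]).IsChain (arcRel rules) := by
  induction w generalizing o with
  | nil =>
    obtain ⟨a, rfl⟩ := Option.ne_none_iff_exists'.1 fun ho => h ho rfl
    simp [pairEnc_nil, arcRel]
  | cons x w ih =>
    have := ih (some x) (by simp)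
    rw [pairEnc_cons]
    cases w <;> simp_all [pairEnc_nil, pairEnc_cons, arcRel]

theorem isChain_psiEnc {w : List A} (h : w ≠ []) :
    (psiEnc m w).IsChain (arcRel rules) := by
  have := isChain_pairEnc (m := m) (rules := rules) none w fun _ => h
  rw [psiEnc_eq]
  cases w <;> simp_all [pairEnc_cons, arcRel]

theorem exists_pairEnc_append (o : Option A) (u : List A) :
    ∃ (U : List (DeltaSym A m)) (o' : Option A), ∀ x w,
      pairEnc m o (u ++ x :: w) = U ++ Sum.inr (o', some x) :: pairEnc m (some x) w := by
  induction u generalizing o with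
  | nil => exact ⟨[], o, fun x w => rfl⟩
  | cons y u ih =>
    obtain ⟨U, o', h⟩ := ih (some y)
    exact ⟨Sum.inr (o, some y) :: U, o', fun x w => by simp [pairEnc_cons, h]⟩

theorem exists_pairEnc_eq_cons (w : List A) :
    ∃ (q : Option A) (Q : List (DeltaSym A m)), ∀ o,
      pairEnc m o w = Sum.inr (o, q) :: Q := by
  cases w with
  | nil => exact ⟨none, [], fun o => rfl⟩
  | cons x w => exact ⟨some x, pairEnc m (some x) w, fun o => rfl⟩

theorem HWordAdj.reflTransGen_of_isChain {D : Type*} {E : D → D → Prop} {u v : List D} {a b : D}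
    (ha : (u ++ a :: v).IsChain E) (hb : (u ++ b :: v).IsChain E) :
    Relation.ReflTransGen (HWordAdj E) (u ++ a :: v) (u ++ b :: v) := by
  by_cases h : a = b
  · rw [h]
  · exact .single ⟨ha, hb, u, a, b, v, h, rfl, rfl⟩

theorem HWordAdj.reflTransGen_through {D : Type*} {E : D → D → Prop} {P Q : List D}
    {p p' x y y' z z' : D} (h : (P ++ p :: z :: y :: Q).IsChain E)
    (h' : (P ++ p' :: z' :: y' :: Q).IsChain E) (hp : E p x) (hp' : E p' x) (hy : E x y)
    (hy' : E x y') :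
    Relation.ReflTransGen (HWordAdj E) (P ++ p :: z :: y :: Q) (P ++ p' :: z' :: y' :: Q) := by
  have mid : ∀ {r s : D}, (P ++ [r]).IsChain E → E r x → E x s → (s :: Q).IsChain E →
      (P ++ r :: x :: s :: Q).IsChain E := fun h1 h2 h3 h4 =>
    List.isChain_append_cons_cons.2 ⟨h1, h2, List.isChain_cons_cons.2 ⟨h3, h4⟩⟩
  have hc := List.isChain_append_cons_cons.1 h
  have hc' := List.isChain_append_cons_cons.1 h'
  have k := (List.isChain_cons_cons.1 hc.2.2).2
  have k' := (List.isChain_cons_cons.1 hc'.2.2).2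
  have m1 := mid hc.1 hp hy k
  have m2 := mid hc'.1 hp' hy k
  have m3 := mid hc'.1 hp' hy' k'
  have s1 := reflTransGen_of_isChain (u := P ++ [p]) (a := z) (b := x) (v := y :: Q)
    (by simpa using h) (by simpa using m1)
  have s2 := reflTransGen_of_isChain m1 m2
  have s3 := reflTransGen_of_isChain (u := P ++ [p', x]) (a := y) (b := y') (v := Q)
    (by simpa using m2) (by simpa using m3)
  have s4 := reflTransGen_of_isChain (u := P ++ [p']) (a := x) (b := z') (v := y' :: Q)
    (by simpa using m3) (by simpa using h')
  simp only [List.append_assoc, List.cons_append, List.nil_append] at s1 s3 s4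
  exact ((s1.trans s2).trans s3).trans s4

theorem RwStep.reflTransGen_psiEnc {s t : List A} (h : RwStep (srsOfRules rules) s t) :
    Relation.ReflTransGen (HWordAdj (arcRel rules)) (psiEnc m s) (psiEnc m t) := by
  obtain ⟨_, ⟨i, hi⟩, u, v, rfl, rfl⟩ := h
  obtain ⟨U, o, hU⟩ := exists_pairEnc_append (m := m) none u
  obtain ⟨q, Q, hQ⟩ := exists_pairEnc_eq_cons (m := m) v
  have hpsi : ∀ a b : A, psiEnc m (u ++ [a, b] ++ v) = (Sum.inl (Sum.inl true) :: U) ++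
      Sum.inr (o, some a) :: Sum.inr (some a, some b) :: Sum.inr (some b, q) ::
        (Q ++ [Sum.inl (Sum.inl false)]) := fun a b => by
    simp [psiEnc_eq, hU, pairEnc_cons, hQ]
  have hch : ∀ a b : A, (psiEnc m (u ++ [a, b] ++ v)).IsChain (arcRel rules) := fun a b =>
    isChain_psiEnc (by simp)
  rcases hi with rfl | rfl <;>
  · simp only [hpsi] at hch ⊢
    apply HWordAdj.reflTransGen_through (x := Sum.inl (Sum.inr i)) (hch _ _) (hch _ _) <;>
      simp [arcRel]

end Rules

/-- For a 2-balanced symmetric SRS each of whose rules changes only one of the two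
symbols, two words `s, t ∈ Γⁿ` are equivalent under the SRS iff their encodings
`ψ(s), ψ(t)` are connected by `H`-word reconfiguration. -/
theorem stmt4 {A : Type*} {m : ℕ} (rules : Fin m → (A × A) × (A × A))
    (hone : ∀ i, (rules i).1.1 = (rules i).2.1 ∨ (rules i).1.2 = (rules i).2.2)
    (n : ℕ) (s t : List A) (hs : s.length = n) (ht : t.length = n) :
    Relation.ReflTransGen (RwStep (srsOfRules rules)) s t ↔
      Relation.ReflTransGen (HWordAdj (arcRel rules)) (psiEnc m s) (psiEnc m t) := by
  constructor
  · intro h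
    clear ht
    induction h with
    | refl => exact .refl
    | tail _ hab ih => exact ih.trans hab.reflTransGen_psiEnc
  · intro h
    have := HWordAdj.reflTransGen_invariant hone h (by simp [psiEnc_eq])
      (by rw [psiEnc_eq, ← List.cons_append, List.getLast?_concat])
    rwa [decodeWord_psiEnc, decodeWord_psiEnc] at this
end

section
/- Let H = (Σ, E_H) be a digraph, n ≥ 1, and let G_n be the simple graph with vertices v₀, v_{n+1} and v_iᵃ for i ∈ {1,…,n}, a ∈ Σ, and edges v₀v₁ᵃ and v_nᵃv_{n+1} for all a ∈ Σ, and v_iᵃ v_{i+1}ᵇ for all (a,b) ∈ E_H and i ∈ {1,…,n−1}. For an H-word w of length n let P_w be the corresponding shortest v₀–v_{n+1} path v₀, v₁^{w₁}, …, v_n^{w_n}, v_{n+1}. Call two shortest v₀–v_{n+1} paths adjacent if their vertex sets differ in exactly one vertex. Then for all H-words s,t of length n: P_s and P_t are connected by a sequence of shortest v₀–v_{n+1} paths in which consecutive paths are adjacent, if and only if s and t are connected by H-word reconfiguration. -/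
/-- The graph `G_n` for a digraph `H = (A, E)`: vertices `v₀ = Sum.inl false`,
`v_{n+1} = Sum.inl true` and `vᵢᵃ = Sum.inr (i, a)` (with `i : Fin n` zero-indexed, so
`Sum.inr (i, a)` is the paper's `v_{i+1}ᵃ`); edges `v₀v₁ᵃ`, `v_nᵃv_{n+1}` for all `a`,
and `vᵢᵃv_{i+1}ᵇ` for all arcs `(a, b)` of `E`. -/
def layerGraph {A : Type*} (E : A → A → Prop) (n : ℕ) :
    SimpleGraph (Bool ⊕ Fin n × A) :=
  SimpleGraph.fromRel fun x y =>
    (∃ (i : Fin n) (a : A), i.val = 0 ∧ x = Sum.inl false ∧ y = Sum.inr (i, a)) ∨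
    (∃ (i : Fin n) (a : A), i.val = n - 1 ∧ x = Sum.inr (i, a) ∧ y = Sum.inl true) ∨
    (∃ (i j : Fin n) (a b : A),
      j.val = i.val + 1 ∧ E a b ∧ x = Sum.inr (i, a) ∧ y = Sum.inr (j, b))

/-- The vertex sequence `v₀, v₁^{w₁}, …, v_n^{w_n}, v_{n+1}` corresponding to a word `w`. -/
def wordSupport {A : Type*} (n : ℕ) (w : List A) : List (Bool ⊕ Fin n × A) :=
  Sum.inl false :: ((List.finRange n).zip w).map Sum.inr ++ [Sum.inl true]

/-- Adjacency of shortest `v₀`–`v_{n+1}` paths: both have length `n + 1` and their vertex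
sets differ in exactly one vertex. -/
def SPathAdj {A : Type*} [DecidableEq A] (E : A → A → Prop) (n : ℕ)
    (p q : (layerGraph E n).Walk (Sum.inl false) (Sum.inl true)) : Prop :=
  p.IsPath ∧ q.IsPath ∧ p.length = n + 1 ∧ q.length = n + 1 ∧
    (p.support.toFinset \ q.support.toFinset).card = 1 ∧
    (q.support.toFinset \ p.support.toFinset).card = 1

/-- The distance from `v₀` of a vertex of `layerGraph E n`. -/
def layerLevel {A : Type*} (n : ℕ) : Bool ⊕ Fin n × A → ℕ
  | Sum.inl false => 0
  | Sum.inl true => n + 1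
  | Sum.inr (i, _) => i.val + 1

section layerGraph

variable {A : Type*} {E : A → A → Prop} {n : ℕ}

lemma layerLevel_of_adj (hn : 1 ≤ n) {x y : Bool ⊕ Fin n × A} (h : (layerGraph E n).Adj x y) :
    layerLevel n x = layerLevel n y + 1 ∨ layerLevel n y = layerLevel n x + 1 := by
  rw [layerGraph, SimpleGraph.fromRel_adj] at h
  rcases h.2 with (⟨i, a, hi, rfl, rfl⟩ | ⟨i, a, hi, rfl, rfl⟩ | ⟨i, j, a, b, hi, -, rfl, rfl⟩) |
      (⟨i, a, hi, rfl, rfl⟩ | ⟨i, a, hi, rfl, rfl⟩ | ⟨i, j, a, b, hi, -, rfl, rfl⟩) <;>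
    simp only [layerLevel] <;> omega

lemma arc_of_layerGraph_adj {i j : Fin n} {a b : A} (hij : j.val = i.val + 1)
    (h : (layerGraph E n).Adj (Sum.inr (i, a)) (Sum.inr (j, b))) : E a b := by
  rw [layerGraph, SimpleGraph.fromRel_adj] at h
  rcases h.2 with (⟨_, _, _, h, _⟩ | ⟨_, _, _, _, h⟩ | ⟨i', j', a', b', h1, hE, h2, h3⟩) |
      (⟨_, _, _, h, _⟩ | ⟨_, _, _, _, h⟩ | ⟨i', j', a', b', h1, hE, h2, h3⟩)
  · simp at h
  · simp at h
  · simp only [Sum.inr.injEq, Prod.mk.injEq] at h2 h3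
    rwa [h2.2, h3.2]
  · simp at h
  · simp at h
  · simp only [Sum.inr.injEq, Prod.mk.injEq] at h2 h3
    obtain ⟨rfl, -⟩ := h2
    obtain ⟨rfl, -⟩ := h3
    omega

lemma wordSupport_ofFn (f : Fin n → A) :
    wordSupport n (List.ofFn f) =
      Sum.inl false :: List.ofFn (fun i => Sum.inr (i, f i)) ++ [Sum.inl true] := by
  have h : ((List.finRange n).zip (List.ofFn f)).map (Sum.inr : _ → Bool ⊕ Fin n × A) =
      List.ofFn (fun i => Sum.inr (i, f i)) := by
    apply List.ext_getElem <;> simp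
  rw [wordSupport, h]

lemma wordSupport_ofFn_injective :
    Function.Injective fun f : Fin n → A => wordSupport n (List.ofFn f) := by
  intro f g h
  simp only [wordSupport_ofFn, List.append_cancel_right_eq, List.cons.injEq, true_and,
    List.ofFn_inj] at h
  funext i
  simpa using congrFun h i

lemma nodup_wordSupport_ofFn (f : Fin n → A) : (wordSupport n (List.ofFn f)).Nodup := by
  rw [wordSupport_ofFn, List.nodup_append, List.nodup_cons, List.nodup_ofFn]
  refine ⟨⟨by simp, fun i j h => ?_⟩, by simp, by simp⟩
  simp only [Sum.inr.injEq, Prod.mk.injEq] at h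
  exact h.1

lemma isChain_wordSupport_ofFn {f : Fin n → A} (hn : 1 ≤ n) (hf : (List.ofFn f).IsChain E) :
    (wordSupport n (List.ofFn f)).IsChain (layerGraph E n).Adj := by
  rw [List.isChain_ofFn] at hf
  rw [wordSupport_ofFn, List.isChain_iff_getElem]
  intro k hk
  simp only [List.length_append, List.length_cons, List.length_ofFn, List.length_nil] at hk
  rw [layerGraph, SimpleGraph.fromRel_adj]
  rcases k with _ | k
  · obtain ⟨m, rfl⟩ : ∃ m, n = m + 1 := ⟨n - 1, by omega⟩
    simp
  · by_cases hkn : k + 1 < n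
    · have := hf k hkn
      simp [hkn, show k < n by omega, this]
    · have hkn' : k < n := by omega
      simp [List.getElem_append, hkn, hkn']
      omega

lemma exists_walk_support_eq {f : Fin n → A} (hn : 1 ≤ n) (hf : (List.ofFn f).IsChain E) :
    ∃ p : (layerGraph E n).Walk (Sum.inl false) (Sum.inl true),
      p.support = wordSupport n (List.ofFn f) := by
  have hc := isChain_wordSupport_ofFn hn hf
  have hne : wordSupport n (List.ofFn f) ≠ [] := by simp [wordSupport]
  have hh : (wordSupport n (List.ofFn f)).head hne = Sum.inl false := by simp [wordSupport]
  have hl : (wordSupport n (List.ofFn f)).getLast hne = Sum.inl true := by simp [wordSupport]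
  refine ⟨(SimpleGraph.Walk.ofSupport _ hne hc).copy hh hl, ?_⟩
  simp

lemma layerLevel_getVert (hn : 1 ≤ n)
    (p : (layerGraph E n).Walk (Sum.inl false) (Sum.inl true)) (hp : p.length = n + 1)
    {k : ℕ} (hk : k ≤ n + 1) : layerLevel n (p.getVert k) = k := by
  have step (j : ℕ) (hj : j < n + 1) :=
    layerLevel_of_adj hn (p.adj_getVert_succ (i := j) (by omega))
  have upper (j : ℕ) : j ≤ n + 1 → layerLevel n (p.getVert j) ≤ j := by
    induction j with
    | zero => simp [layerLevel]
    | succ j ih => intro hj; have := step j hj; have := ih (by omega); omega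
  have lower (j : ℕ) : j ≤ n + 1 → n + 1 ≤ layerLevel n (p.getVert (n + 1 - j)) + j := by
    induction j with
    | zero => simp [← hp, layerLevel]
    | succ j ih =>
      intro hj
      have h1 := step (n + 1 - (j + 1)) (by omega)
      have h2 := ih (by omega)
      rw [show n + 1 - (j + 1) + 1 = n + 1 - j by omega] at h1
      omega
  have h1 := upper k hk
  have h2 := lower (n + 1 - k) (by omega)
  rw [show n + 1 - (n + 1 - k) = k by omega] at h2
  omega

lemma exists_word_support_eq (hn : 1 ≤ n)
    (p : (layerGraph E n).Walk (Sum.inl false) (Sum.inl true)) (hp : p.length = n + 1) :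
    ∃ f : Fin n → A, (List.ofFn f).IsChain E ∧ p.support = wordSupport n (List.ofFn f) := by
  have h (i : Fin n) : ∃ a, p.getVert (i + 1) = Sum.inr (i, a) := by
    have hi := layerLevel_getVert hn p hp (k := i + 1) (by omega)
    rcases hv : p.getVert (i + 1) with (_ | _) | ⟨j, a⟩
    · simp [hv, layerLevel] at hi
    · simp only [hv, layerLevel] at hi
      omega
    · simp only [hv, layerLevel, add_left_inj, Fin.val_inj] at hi
      exact ⟨a, by rw [hi]⟩
  choose f hf using h
  refine ⟨f, ?_, ?_⟩
  · rw [List.isChain_ofFn]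
    intro i hi
    have := p.adj_getVert_succ (i := i + 1) (by omega)
    rw [hf ⟨i, by omega⟩, hf ⟨i + 1, hi⟩] at this
    exact arc_of_layerGraph_adj rfl this
  · rw [wordSupport_ofFn]
    apply List.ext_getElem
    · simp [hp]
    · intro k hk hk'
      rw [SimpleGraph.Walk.support_getElem_eq_getVert]
      simp only [SimpleGraph.Walk.length_support, hp] at hk
      rcases k with _ | k
      · simp
      · by_cases hkn : k < n
        · simp [hkn, hf ⟨k, hkn⟩]
        · have hkl : k + 1 = p.length := by omega
          simp [List.getElem_append, hkn, p.getVert_of_length_le hkl.ge]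

lemma card_wordSupport_sdiff [DecidableEq A] (f g : Fin n → A) :
    ((wordSupport n (List.ofFn f)).toFinset \ (wordSupport n (List.ofFn g)).toFinset).card =
      (Finset.univ.filter fun i => f i ≠ g i).card := by
  have h : (wordSupport n (List.ofFn f)).toFinset \ (wordSupport n (List.ofFn g)).toFinset =
      (Finset.univ.filter fun i => f i ≠ g i).image fun i => Sum.inr (i, f i) := by
    ext (b | ⟨i, a⟩)
    · cases b <;> simp [wordSupport_ofFn]
    · simp only [wordSupport_ofFn, Finset.mem_sdiff, List.mem_toFinset, List.mem_append,
        List.mem_cons, List.mem_ofFn, Finset.mem_image, Finset.mem_filter, Finset.mem_univ]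
      grind
  rw [h, Finset.card_image_of_injective]
  intro i j hij
  simp only [Sum.inr.injEq, Prod.mk.injEq] at hij
  exact hij.1

lemma oneDiff_ofFn_iff (f g : Fin n → A) :
    OneDiff (List.ofFn f) (List.ofFn g) ↔ ∃! i, f i ≠ g i := by
  constructor
  · rintro ⟨u, a, b, v, hab, hf, hg⟩
    have hlen := congrArg List.length hf
    simp only [List.length_ofFn, List.length_append, List.length_cons] at hlen
    have hf' (i : Fin n) : f i = (u ++ a :: v)[i.val]'(by simp; omega) := by
      simp [← hf]
    have hg' (i : Fin n) : g i = (u ++ b :: v)[i.val]'(by simp; omega) := by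
      simp [← hg]
    refine ⟨⟨u.length, by omega⟩, by simp [hf', hg', hab], fun i hi => ?_⟩
    by_contra hne
    rw [Fin.ext_iff] at hne
    simp only [hf', hg'] at hi
    grind
  · rintro ⟨i, hi, huniq⟩
    have heq (j : Fin n) (hj : j ≠ i) : f j = g j := by
      by_contra h
      exact hj (huniq j h)
    have hu : (List.ofFn f).take i = (List.ofFn g).take i := by
      apply List.ext_getElem
      · simp
      · intro k hk _
        simp only [List.length_take, List.length_ofFn] at hk
        simp only [List.getElem_take, List.getElem_ofFn]
        exact heq _ (by rw [Ne, Fin.ext_iff]; dsimp only; omega)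
    have hv : (List.ofFn f).drop (i + 1) = (List.ofFn g).drop (i + 1) := by
      apply List.ext_getElem
      · simp
      · intro k hk _
        simp only [List.getElem_drop, List.getElem_ofFn]
        exact heq _ (by rw [Ne, Fin.ext_iff]; dsimp only; omega)
    refine ⟨(List.ofFn f).take i, f i, g i, (List.ofFn f).drop (i + 1), hi, ?_, ?_⟩
    · apply List.ext_getElem <;> grind
    · rw [hu, hv]
      apply List.ext_getElem <;> grind

lemma sPathAdj_iff_oneDiff [DecidableEq A] {f g : Fin n → A}
    {p q : (layerGraph E n).Walk (Sum.inl false) (Sum.inl true)}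
    (hp : p.support = wordSupport n (List.ofFn f))
    (hq : q.support = wordSupport n (List.ofFn g)) :
    SPathAdj E n p q ↔ OneDiff (List.ofFn f) (List.ofFn g) := by
  have length_eq {h : Fin n → A} {r : (layerGraph E n).Walk (Sum.inl false) (Sum.inl true)}
      (hr : r.support = wordSupport n (List.ofFn h)) : r.length = n + 1 := by
    have := congrArg List.length hr
    simpa [wordSupport_ofFn] using this
  have hcard : (Finset.univ.filter fun i => f i ≠ g i).card = 1 ↔ ∃! i, f i ≠ g i := by
    simp [Finset.card_eq_one, Finset.ext_iff, ExistsUnique, iff_def, forall_and, and_comm]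
  rw [SPathAdj, hp, hq, card_wordSupport_sdiff, card_wordSupport_sdiff]
  simp only [ne_comm (a := g _), hcard, oneDiff_ofFn_iff, SimpleGraph.Walk.isPath_def, hp, hq,
    nodup_wordSupport_ofFn, length_eq hp, length_eq hq, true_and, and_self]

lemma OneDiff.length_eq {w w' : List A} (h : OneDiff w w') : w.length = w'.length := by
  obtain ⟨u, a, b, v, -, rfl, rfl⟩ := h
  simp

end layerGraph

/-- The shortest paths `P_s` and `P_t` corresponding to `H`-words `s` and `t` are connected
by a sequence of shortest `v₀`–`v_{n+1}` paths with consecutive ones adjacent, if and only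
if `s` and `t` are connected by `H`-word reconfiguration. -/
theorem stmt8 {A : Type*} [DecidableEq A] (E : A → A → Prop) (n : ℕ) (hn : 1 ≤ n)
    (s t : List A) (hs : s.length = n) (hsc : s.Chain' E)
    (ht : t.length = n) (htc : t.Chain' E)
    (ps pt : (layerGraph E n).Walk (Sum.inl false) (Sum.inl true))
    (hps : ps.IsPath) (hpsl : ps.length = n + 1) (hpss : ps.support = wordSupport n s)
    (hpt : pt.IsPath) (hptl : pt.length = n + 1) (hpts : pt.support = wordSupport n t) :
    Relation.ReflTransGen (SPathAdj E n) ps pt ↔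
      Relation.ReflTransGen (HWordAdj E) s t := by
  obtain ⟨f, rfl⟩ : ∃ f : Fin n → A, s = List.ofFn f := by
    subst hs
    exact ⟨s.get, (List.ofFn_get s).symm⟩
  obtain ⟨g, rfl⟩ : ∃ g : Fin n → A, t = List.ofFn g := by
    subst ht
    exact ⟨t.get, (List.ofFn_get t).symm⟩
  constructor
  · intro h
    have key : ∃ k : Fin n → A, (List.ofFn k).IsChain E ∧ pt.support = wordSupport n (List.ofFn k) ∧
        Relation.ReflTransGen (HWordAdj E) (List.ofFn f) (List.ofFn k) := by
      clear hpts hptl hpt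
      induction h with
      | refl => exact ⟨f, hsc, hpss, .refl⟩
      | @tail p q _ hpq ih =>
        obtain ⟨k, hkc, hks, hk⟩ := ih
        obtain ⟨l, hlc, hls⟩ := exists_word_support_eq hn q hpq.2.2.2.1
        exact ⟨l, hlc, hls, hk.tail ⟨hkc, hlc, (sPathAdj_iff_oneDiff hks hls).1 hpq⟩⟩
    obtain ⟨k, -, hks, hk⟩ := key
    rwa [wordSupport_ofFn_injective (hpts.symm.trans hks)]
  · intro h
    have key (w : List A) (hw : Relation.ReflTransGen (HWordAdj E) (List.ofFn f) w) :
        ∃ (k : Fin n → A) (q : (layerGraph E n).Walk (Sum.inl false) (Sum.inl true)),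
          w = List.ofFn k ∧ q.support = wordSupport n (List.ofFn k) ∧
          Relation.ReflTransGen (SPathAdj E n) ps q := by
      induction hw with
      | refl => exact ⟨f, ps, rfl, hpss, .refl⟩
      | @tail w w' _ hww ih =>
        obtain ⟨k, q, rfl, hks, hk⟩ := ih
        obtain ⟨-, hc, hd⟩ := hww
        obtain ⟨l, rfl⟩ : ∃ l : Fin n → A, w' = List.ofFn l := by
          have hlen : n = w'.length := by simpa using hd.length_eq
          subst hlen
          exact ⟨w'.get, (List.ofFn_get w').symm⟩
        obtain ⟨r, hr⟩ := exists_walk_support_eq hn hc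
        exact ⟨l, r, rfl, hr, hk.tail ((sPathAdj_iff_oneDiff hks hr).2 hd)⟩
    obtain ⟨k, q, hgk, hq, hk⟩ := key _ h
    rwa [SimpleGraph.Walk.ext_support (hpts.trans (hgk ▸ hq.symm))]
end
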